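/- For every i = 1,…,7 the element s_i = t_i t_{i+7} of 𝒢 is an involution, i.e. (t_i t_{i+7})^2 = 1; equivalently, t_i and t_{i+7} commute, so s_i = s_{i+7} where s_{i+7} = t_{i+7} t_i. -/

import Mathlib

/-!
Symmetric generation of `M₂₂` (Hasan–Lim).  `G` is the quotient of the free
group on three generators `x, y, t` by the normal closure of the relators
`x^7, y^2, (xy)^3, [x,y]^4, t^2, [t^{x^2}, y x⁻¹], [t, y],
 (y t^{x^2})^5, (x y x^2 t^x)^5, (x t)^8`,
where `a ^ b := b⁻¹ a b` and `[a, b] := a⁻¹ b⁻¹ a b`.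
-/

namespace M22

abbrev F := FreeGroup (Fin 3)
def fx : F := FreeGroup.of 0
def fy : F := FreeGroup.of 1
def ft : F := FreeGroup.of 2

/-- conjugation `a ^ b = b⁻¹ * a * b` -/
def fconj (a b : F) : F := b⁻¹ * a * b
/-- commutator `[a, b] = a⁻¹ * b⁻¹ * a * b` -/
def fcomm (a b : F) : F := a⁻¹ * b⁻¹ * a * b

def rels : Set F :=
  {fx ^ 7, fy ^ 2, (fx * fy) ^ 3, (fcomm fx fy) ^ 4, ft ^ 2,
   fcomm (fconj ft (fx ^ 2)) (fy * fx⁻¹), fcomm ft fy,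
   (fy * fconj ft (fx ^ 2)) ^ 5, (fx * fy * fx ^ 2 * fconj ft fx) ^ 5,
   (fx * ft) ^ 8}

abbrev G := PresentedGroup rels

def x : G := PresentedGroup.of 0
def y : G := PresentedGroup.of 1
def t : G := PresentedGroup.of 2

/-- The symmetric generators `t₁, …, t₁₄`: for `1 ≤ i ≤ 7`, `tᵢ = t ^ (xⁱ)`,
and for `1 ≤ k ≤ 7`, `t₍₇₊ₖ₎ = t ^ (x⁵ y x^(k-1))`; the index is read modulo
`14` with representatives `1, …, 14`. -/
def tt (i : ℕ) : G :=
  let j := (i - 1) % 14 + 1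
  if j ≤ 7 then (x ^ j)⁻¹ * t * x ^ j
  else (x ^ 5 * y * x ^ (j - 8))⁻¹ * t * (x ^ 5 * y * x ^ (j - 8))

/-- Word identities in a `(2,3,7;4)`-group, i.e. a quotient of `PSL(2,7)`, acting on the left of `z`. -/
theorem psl_words {M : Type*} [Monoid M] (x X y : M)
    (r0 : ∀ z : M, x * (X * z) = z)
    (r1 : ∀ z : M, X * (x * z) = z)
    (r2 : ∀ z : M, y * (y * z) = z)
    (r3 : ∀ z : M, x * (x * (x * (x * (x * (x * (x * z)))))) = z)
    (r4 : ∀ z : M, x * (y * (x * (y * (x * (y * z))))) = z)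
    (r5 : ∀ z : M, X * (y * (x * (y * (X * (y * (x * (y * (X * (y * (x * (y * (X * (y * (x * (y * z))))))))))))))) = z)
    (z : M) :
    x * (x * (x * (y * (x * (x * (x * (y * (x * (x * (x * (y * (x * (x * (x * (y * z))))))))))))))) = z ∧
    y * (X * (X * (X * (y * (x * z))))) = X * (X * (X * (y * (x * (x * (x * (x * (y * (x * (x * (x * (y * z)))))))))))) ∧
    x * (x * (X * (X * (X * (y * (x * z)))))) = x * (x * (x * (y * (X * (X * (y * (x * (x * (y * (X * (X * (X * (x * (x * (x * (x * (x * (y * (x * (x * (x * (x * (x * (x * z)))))))))))))))))))))))) ∧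
    x * (x * (x * (x * (x * (y * (x * (x * (x * (x * (x * (x * (x * (x * (x * (y * (x * (x * (x * (y * z))))))))))))))))))) = y * (x * (x * (y * (X * (X * (X * (x * z))))))) ∧
    x * (x * (y * (X * (X * (x * (x * (y * (X * (X * z))))))))) = z ∧
    x * (x * (y * (X * (X * z)))) = x * (x * (y * (X * (X * (X * (x * z)))))) ∧
    x * (y * (x * (x * (X * (X * (X * (y * (X * (X * (X * (y * (x * (x * (y * (X * (X * (X * (y * (x * z))))))))))))))))))) = X * (X * (X * (y * (X * (X * (X * (y * z))))))) ∧
    x * (X * (X * (X * (y * (X * (X * (X * (y * z)))))))) = x * (x * (y * (X * (X * (X * (y * (x * (x * (x * (y * (X * (X * (x * z))))))))))))) ∧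
    x * (x * (y * (X * (X * (X * (y * (x * (x * (x * (y * (X * (X * (X * (y * (x * (x * (x * (y * (X * (X * (X * (y * (x * (x * (x * (y * (X * (X * (X * (y * (x * z))))))))))))))))))))))))))))))) = z ∧
    x * (x * (x * (y * (X * (X * (X * (y * (x * z)))))))) = y * (x * (x * (x * (y * (X * (X * (y * (x * (x * (x * (x * (x * (y * (x * (x * (x * (x * (x * (x * z))))))))))))))))))) ∧
    x * (x * (x * (x * (x * (y * (x * (x * (x * (x * (x * (x * (x * (x * (y * (X * (X * (X * (y * (x * z))))))))))))))))))) = x * (x * (x * (y * (X * (X * (y * (x * (x * (x * (x * (x * (y * z)))))))))))) ∧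
    x * (x * (x * (x * (x * (y * (x * (x * (y * (X * (X * (X * (y * (x * z))))))))))))) = y * (x * (x * (y * (X * (X * (X * (y * z))))))) ∧
    x * (x * (y * (X * (X * (X * (y * (x * z))))))) = x * (x * (y * (X * (X * (X * (y * (x * z))))))) ∧
    x * (x * (x * (x * (x * (y * (x * (x * (x * (x * (x * (x * (x * (x * (y * (X * (X * z)))))))))))))))) = y * (x * (x * (x * (y * (X * (X * (x * (x * (x * (x * (x * (y * z)))))))))))) ∧
    x * (x * (x * (y * (x * (x * (x * (y * (x * (x * (y * (X * (X * (X * (y * (x * (x * (x * (y * (X * (X * z)))))))))))))))))))) = x * (x * (y * (X * (X * (X * (y * (x * z))))))) := by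
  have r6 (z : M) : x * (x * (x * (x * (x * (x * (x * z)))))) = z := by
    exact r3 _
  have r7 (z : M) : x * (y * (x * (y * (x * (y * z))))) = z := by
    exact r4 _
  have r8 (z : M) : X * (y * (x * (y * (X * (y * (x * (y * (X * (y * (x * (y * (X * (y * (x * (y * z))))))))))))))) = z := by
    exact r5 _
  have r9 (z : M) : y * (x * (y * (x * (y * z)))) = X * z := by
    calc _ = _ := (r1 _).symm
      _ = _ := congrArg (fun v => X * v) (r7 _)
  have r10 (z : M) : x * (y * (x * (y * z))) = y * (X * z) := by
    calc _ = _ := (r2 _).symm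
      _ = _ := congrArg (fun v => y * v) (r9 _)
  have r11 (z : M) : y * (x * (y * z)) = X * (y * (X * z)) := by
    calc _ = _ := (r1 _).symm
      _ = _ := congrArg (fun v => X * v) (r10 _)
  have r12 (z : M) : X * (X * (y * (X * (X * (X * (y * (X * (X * (X * (y * (X * (X * (X * (y * (X * z))))))))))))))) = z := by
    calc _ = _ := congrArg (fun v => X * (X * (y * (X * (X * (X * (y * (X * (X * (X * (y * (X * (X * v))))))))))))) ((r11 _).symm)
      _ = _ := congrArg (fun v => X * (X * (y * (X * (X * (X * (y * (X * (X * v))))))))) ((r11 _).symm)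
      _ = _ := congrArg (fun v => X * (X * (y * (X * (X * v))))) ((r11 _).symm)
      _ = _ := congrArg (fun v => X * v) ((r11 _).symm)
      _ = _ := r8 _
  have r14 (z : M) : X * (y * (X * (y * z))) = y * (x * z) := by
    calc _ = _ := (r11 _).symm
      _ = _ := congrArg (fun v => y * (x * v)) (r2 _)
  have r15 (z : M) : y * (X * (y * z)) = x * (y * (x * z)) := by
    calc _ = _ := (r0 _).symm
      _ = _ := congrArg (fun v => x * v) (r14 _)
  have r16 (z : M) : y * (x * (x * (y * (x * z)))) = X * (y * (X * (X * (y * z)))) := by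
    calc _ = _ := congrArg (fun v => y * (x * v)) ((r15 _).symm)
      _ = _ := r11 _
  have r17 (z : M) : y * (X * (X * (y * (X * z)))) = x * (y * (x * (x * (y * z)))) := by
    calc _ = _ := congrArg (fun v => y * (X * v)) ((r11 _).symm)
      _ = _ := r15 _
  have r18 (z : M) : x * (x * (x * (x * (x * (x * z))))) = X * z := by
    calc _ = _ := (r1 _).symm
      _ = _ := congrArg (fun v => X * v) (r6 _)
  have r19 (z : M) : x * (x * (x * (x * (x * z)))) = X * (X * z) := by
    calc _ = _ := (r1 _).symm
      _ = _ := congrArg (fun v => X * v) (r18 _)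
  have r20 (z : M) : x * (x * (x * (x * z))) = X * (X * (X * z)) := by
    calc _ = _ := (r1 _).symm
      _ = _ := congrArg (fun v => X * v) (r19 _)
  have r21 (z : M) : X * (X * (X * (X * z))) = x * (x * (x * z)) := by
    calc _ = _ := congrArg (fun v => X * v) ((r20 _).symm)
      _ = _ := r1 _
  have r22 (z : M) : X * (y * (X * (X * (y * (x * (x * (x * z))))))) = y * (x * (x * (y * (X * (X * (X * z)))))) := by
    calc _ = _ := (r16 _).symm
      _ = _ := congrArg (fun v => y * (x * (x * (y * v)))) (r20 _)
  have r23 (z : M) : x * (y * (x * (x * (y * (X * (X * (X * z))))))) = y * (X * (X * (y * (x * (x * (x * z)))))) := by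
    calc _ = _ := (r17 _).symm
      _ = _ := congrArg (fun v => y * (X * (X * (y * v)))) (r21 _)
  have r26 (z : M) : X * (y * (X * (X * (X * (y * (X * (X * (X * (y * (X * (X * (X * (y * (X * z)))))))))))))) = x * z := by
    calc _ = _ := (r0 _).symm
      _ = _ := congrArg (fun v => x * v) (r12 _)
  have r27 (z : M) : y * (X * (X * (X * (y * (X * (X * (X * (y * (X * (X * (X * (y * (X * z))))))))))))) = x * (x * z) := by
    calc _ = _ := (r0 _).symm
      _ = _ := congrArg (fun v => x * v) (r26 _)
  have r28 (z : M) : X * (X * (X * (y * (X * (X * (X * (y * (X * (X * (X * (y * (X * z)))))))))))) = y * (x * (x * z)) := by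
    calc _ = _ := (r2 _).symm
      _ = _ := congrArg (fun v => y * v) (r27 _)
  have r29 (z : M) : X * (X * (y * (X * (X * (X * (y * (X * (X * (X * (y * (X * z))))))))))) = x * (y * (x * (x * z))) := by
    calc _ = _ := (r0 _).symm
      _ = _ := congrArg (fun v => x * v) (r28 _)
  have r30 (z : M) : X * (y * (X * (X * (X * (y * (X * (X * (X * (y * (X * z)))))))))) = x * (x * (y * (x * (x * z)))) := by
    calc _ = _ := (r0 _).symm
      _ = _ := congrArg (fun v => x * v) (r29 _)
  have r31 (z : M) : y * (X * (X * (X * (y * (X * (X * (X * (y * (X * z))))))))) = x * (x * (x * (y * (x * (x * z))))) := by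
    calc _ = _ := (r0 _).symm
      _ = _ := congrArg (fun v => x * v) (r30 _)
  have r32 (z : M) : X * (X * (X * (y * (X * (X * (X * (y * (X * z)))))))) = y * (x * (x * (x * (y * (x * (x * z)))))) := by
    calc _ = _ := (r2 _).symm
      _ = _ := congrArg (fun v => y * v) (r31 _)
  have r33 (z : M) : x * (y * (x * (x * (x * (y * (x * (x * z))))))) = X * (X * (y * (X * (X * (X * (y * (X * z))))))) := by
    calc _ = _ := congrArg (fun v => x * v) ((r32 _).symm)
      _ = _ := r0 _
  have r34 (z : M) : X * (X * (y * (X * (X * (X * (y * (X * (X * z)))))))) = x * (y * (x * (x * (x * (y * (x * z)))))) := by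
    calc _ = _ := (r33 _).symm
      _ = _ := congrArg (fun v => x * (y * (x * (x * (x * (y * (x * v))))))) (r0 _)
  have r35 (z : M) : x * (x * (y * (x * (x * (x * (y * (x * z))))))) = X * (y * (X * (X * (X * (y * (X * (X * z))))))) := by
    calc _ = _ := congrArg (fun v => x * v) ((r34 _).symm)
      _ = _ := r0 _
  have r36 (z : M) : X * (y * (X * (X * (X * (y * (X * (X * (X * z)))))))) = x * (x * (y * (x * (x * (x * (y * z)))))) := by
    calc _ = _ := (r35 _).symm
      _ = _ := congrArg (fun v => x * (x * (y * (x * (x * (x * (y * v))))))) (r0 _)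
  have r37 (z : M) : y * (X * (X * (X * (y * (X * (X * (X * z))))))) = x * (x * (x * (y * (x * (x * (x * (y * z))))))) := by
    calc _ = _ := (r0 _).symm
      _ = _ := congrArg (fun v => x * v) (r36 _)
  have r39 (z : M) : y * (X * (X * (X * (y * (x * (x * (x * (y * z)))))))) = X * (y * (x * (x * (x * (y * (X * (X * (X * z)))))))) := by
    calc _ = _ := congrArg (fun v => y * v) ((r20 _).symm)
      _ = _ := congrArg (fun v => y * (x * v)) ((r37 _).symm)
      _ = _ := r11 _
      _ = _ := congrArg (fun v => X * (y * v)) (r21 _)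
  have r40 (z : M) : x * (x * (y * (x * (x * (y * (X * (X * z))))))) = X * (y * (X * (X * (y * (x * (x * (y * z))))))) := by
    calc _ = _ := congrArg (fun v => x * v) ((r17 _).symm)
      _ = _ := congrArg (fun v => x * (y * v)) ((r0 _).symm)
      _ = _ := (r15 _).symm
      _ = _ := congrArg (fun v => y * (X * v)) (r37 _)
      _ = _ := congrArg (fun v => y * v) (r1 _)
      _ = _ := r16 _
  have r41 (z : M) : X * (X * (y * (X * (X * (y * (x * (x * (y * z)))))))) = x * (y * (x * (x * (y * (X * (X * z)))))) := by
    calc _ = _ := congrArg (fun v => X * v) ((r40 _).symm)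
      _ = _ := r1 _
  have r42 (z : M) : X * (y * (X * (X * (X * (y * (X * (X * (y * z)))))))) = x * (x * (y * (x * (x * (y * (X * z)))))) := by
    calc _ = _ := congrArg (fun v => X * (y * (X * (X * v)))) ((r16 _).symm)
      _ = _ := (r40 _).symm
      _ = _ := congrArg (fun v => x * (x * (y * (x * (x * (y * (X * v))))))) (r1 _)
  have r43 (z : M) : y * (X * (X * (X * (y * (X * (X * (y * z))))))) = x * (x * (x * (y * (x * (x * (y * (X * z))))))) := by
    calc _ = _ := (r0 _).symm
      _ = _ := congrArg (fun v => x * v) (r42 _)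
  have r44 (z : M) : y * (x * (x * (x * (y * (x * (x * (y * (X * z)))))))) = X * (X * (X * (y * (X * (X * (y * z)))))) := by
    calc _ = _ := congrArg (fun v => y * v) ((r43 _).symm)
      _ = _ := r2 _
  have r47 (z : M) : y * (x * (x * (x * (y * (x * (x * (x * z))))))) = X * (X * (X * (y * (X * (X * (X * (y * z))))))) := by
    calc _ = _ := (r32 _).symm
      _ = _ := congrArg (fun v => X * (X * (X * (y * (X * (X * (X * (y * v)))))))) (r1 _)
  have r48 (z : M) : x * (y * (x * (x * (y * (X * (X * (y * z))))))) = X * (X * (y * (X * (X * (y * (x * (x * z))))))) := by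
    calc _ = _ := (r17 _).symm
      _ = _ := congrArg (fun v => y * v) ((r0 _).symm)
      _ = _ := congrArg (fun v => y * (x * v)) ((r47 _).symm)
      _ = _ := r11 _
      _ = _ := congrArg (fun v => X * (y * v)) (r1 _)
      _ = _ := congrArg (fun v => X * v) (r16 _)
  have r50 (z : M) : y * (x * (x * (x * (y * (X * (X * (X * (y * z)))))))) = x * (y * (X * (X * (X * (y * (x * (x * (x * z)))))))) := by
    calc _ = _ := congrArg (fun v => y * v) ((r21 _).symm)
      _ = _ := congrArg (fun v => y * (X * v)) ((r47 _).symm)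
      _ = _ := r15 _
      _ = _ := congrArg (fun v => x * (y * v)) (r20 _)
  have r51 (z : M) : y * (x * (x * (x * (y * (x * (x * (y * z))))))) = X * (X * (X * (y * (X * (X * (y * (x * z))))))) := by
    calc _ = _ := congrArg (fun v => y * (x * (x * (x * (y * (x * (x * (y * v)))))))) ((r1 _).symm)
      _ = _ := r44 _
  have r52 (z : M) : y * (x * (x * (x * (y * (X * (X * (y * (x * z)))))))) = x * (y * (X * (X * (X * (y * (x * (x * (y * z)))))))) := by
    calc _ = _ := congrArg (fun v => y * v) ((r21 _).symm)
      _ = _ := congrArg (fun v => y * (X * v)) ((r51 _).symm)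
      _ = _ := r15 _
      _ = _ := congrArg (fun v => x * (y * v)) (r20 _)
  have r53 (z : M) : y * (X * (X * (y * (x * (x * (x * (y * (X * z)))))))) = X * (y * (x * (x * (y * (X * (X * (X * (y * z)))))))) := by
    calc _ = _ := (r23 _).symm
      _ = _ := congrArg (fun v => x * (y * (x * (x * (y * (X * (X * v))))))) ((r11 _).symm)
      _ = _ := r48 _
      _ = _ := congrArg (fun v => X * v) (r22 _)
  have r54 (z : M) : x * (x * (y * (X * (X * (X * (y * (x * (x * (x * z))))))))) = X * (X * (y * (x * (x * (x * (y * (X * z))))))) := by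
    calc _ = _ := congrArg (fun v => x * v) ((r50 _).symm)
      _ = _ := (r15 _).symm
      _ = _ := congrArg (fun v => y * v) ((r53 _).symm)
      _ = _ := r2 _
  have r55 (z : M) : X * (y * (x * (x * (y * (X * (X * (X * (y * (x * z))))))))) = y * (X * (X * (y * (x * (x * (x * (y * z))))))) := by
    calc _ = _ := (r53 _).symm
      _ = _ := congrArg (fun v => y * (X * (X * (y * (x * (x * (x * (y * v)))))))) (r1 _)
  have r56 (z : M) : y * (x * (x * (y * (X * (X * (X * (y * (x * z)))))))) = x * (y * (X * (X * (y * (x * (x * (x * (y * z)))))))) := by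
    calc _ = _ := (r0 _).symm
      _ = _ := congrArg (fun v => x * v) (r55 _)
  have r57 (z : M) : X * (X * (y * (x * (x * (x * (y * (X * (X * (X * z))))))))) = x * (x * (y * (X * (X * (X * (y * (x * z))))))) := by
    calc _ = _ := congrArg (fun v => X * v) ((r39 _).symm)
      _ = _ := (r11 _).symm
      _ = _ := congrArg (fun v => y * v) ((r56 _).symm)
      _ = _ := r2 _
  have r58 (z : M) : x * (x * (x * (y * (X * (X * (X * (y * (x * z)))))))) = X * (y * (x * (x * (x * (y * (X * (X * (X * z)))))))) := by
    calc _ = _ := congrArg (fun v => x * v) ((r57 _).symm)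
      _ = _ := r0 _
  have r59 (z : M) : x * (y * (X * (X * (X * (y * (x * (x * (x * z)))))))) = X * (X * (X * (y * (x * (x * (x * (y * (X * z)))))))) := by
    calc _ = _ := (r1 _).symm
      _ = _ := congrArg (fun v => X * v) (r54 _)
  have r60 (z : M) : x * (x * (x * (y * (x * (x * (x * (y * (X * z)))))))) = y * (X * (X * (X * (y * (x * (x * (x * z))))))) := by
    calc _ = _ := (r21 _).symm
      _ = _ := congrArg (fun v => X * v) ((r59 _).symm)
      _ = _ := r1 _
  have r69 (z : M) : x * (y * (X * (X * (y * (x * (x * (y * (X * z)))))))) = X * (y * (x * (x * (y * (X * (X * (y * (x * z)))))))) := by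
    calc _ = _ := congrArg (fun v => x * (y * (X * (X * (y * (x * (x * v))))))) ((r0 _).symm)
      _ = _ := congrArg (fun v => x * (y * (X * (X * (y * (x * (x * (x * v)))))))) ((r11 _).symm)
      _ = _ := (r56 _).symm
      _ = _ := congrArg (fun v => y * (x * v)) ((r52 _).symm)
      _ = _ := r11 _
      _ = _ := congrArg (fun v => X * (y * v)) (r1 _)
  have r71 (z : M) : X * (y * (x * (x * (y * (X * (X * (y * (x * (x * z))))))))) = x * (y * (X * (X * (y * (x * (x * (y * z))))))) := by
    calc _ = _ := (r69 _).symm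
      _ = _ := congrArg (fun v => x * (y * (X * (X * (y * (x * (x * (y * v)))))))) (r1 _)
  have r72 (z : M) : y * (x * (x * (y * (X * (X * (y * (x * (x * z)))))))) = x * (x * (y * (X * (X * (y * (x * (x * (y * z)))))))) := by
    calc _ = _ := (r0 _).symm
      _ = _ := congrArg (fun v => x * v) (r71 _)
  have r73 (z : M) : x * (x * (y * (X * (X * (X * (y * (X * (X * z)))))))) = X * (X * (y * (x * (x * (x * (y * (x * z))))))) := by
    calc _ = _ := congrArg (fun v => x * (x * (y * (X * (X * v))))) ((r11 _).symm)
      _ = _ := congrArg (fun v => x * (x * (y * (X * (X * (y * (x * v))))))) ((r0 _).symm)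
      _ = _ := congrArg (fun v => x * (x * (y * (X * (X * (y * (x * (x * v)))))))) ((r11 _).symm)
      _ = _ := (r72 _).symm
      _ = _ := congrArg (fun v => y * (x * v)) ((r56 _).symm)
      _ = _ := r11 _
      _ = _ := congrArg (fun v => X * (y * v)) (r1 _)
      _ = _ := congrArg (fun v => X * v) (r11 _)
      _ = _ := congrArg (fun v => X * (X * (y * v))) (r21 _)
  have r74 (z : M) : X * (X * (X * (y * (x * (x * (x * (y * (x * z)))))))) = x * (y * (X * (X * (X * (y * (X * (X * z))))))) := by
    calc _ = _ := congrArg (fun v => X * v) ((r73 _).symm)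
      _ = _ := r1 _
  refine ⟨?_, ?_, ?_, ?_, ?_, ?_, ?_, ?_, ?_, ?_, ?_, ?_, ?_, ?_, ?_⟩
  · calc _ = _ := congrArg (fun v => x * (x * v)) (r33 _)
      _ = _ := congrArg (fun v => x * v) (r0 _)
      _ = _ := r0 _
      _ = _ := congrArg (fun v => y * (X * (X * (X * (y * v))))) (r1 _)
      _ = _ := congrArg (fun v => y * (X * (X * (X * v)))) (r2 _)
      _ = _ := congrArg (fun v => y * (X * (X * v))) (r1 _)
      _ = _ := congrArg (fun v => y * (X * v)) (r1 _)
      _ = _ := congrArg (fun v => y * v) (r1 _)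
      _ = _ := r2 _
  · calc _ = _ := congrArg (fun v => y * (X * (X * (X * (y * (x * v)))))) ((r0 _).symm)
      _ = _ := congrArg (fun v => y * (X * (X * (X * (y * (x * (x * v))))))) ((r0 _).symm)
      _ = _ := (r60 _).symm
      _ = _ := (r21 _).symm
      _ = _ := congrArg (fun v => X * (X * (X * v))) ((r39 _).symm)
      _ = _ := congrArg (fun v => X * (X * (X * (y * v)))) ((r20 _).symm)
  · calc _ = _ := congrArg (fun v => x * v) (r0 _)
      _ = _ := r0 _
      _ = _ := congrArg (fun v => X * v) ((r1 _).symm)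
      _ = _ := congrArg (fun v => X * (X * v)) ((r1 _).symm)
      _ = _ := (r20 _).symm
      _ = _ := congrArg (fun v => x * (x * (x * v))) ((r2 _).symm)
      _ = _ := congrArg (fun v => x * (x * (x * (y * (y * (x * (x * (x * (y * (x * v)))))))))) ((r0 _).symm)
      _ = _ := congrArg (fun v => x * (x * (x * (y * v)))) ((r32 _).symm)
      _ = _ := congrArg (fun v => x * (x * (x * (y * (X * (X * (X * (y * (X * (X * (X * (y * (X * (X * v)))))))))))))) ((r1 _).symm)
      _ = _ := congrArg (fun v => x * (x * (x * (y * (X * (X * (X * (y * (X * (X * (X * (y * v)))))))))))) ((r20 _).symm)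
      _ = _ := congrArg (fun v => x * (x * (x * (y * (X * (X * (X * (y * (X * (X * (X * (y * v)))))))))))) ((r1 _).symm)
      _ = _ := congrArg (fun v => x * (x * (x * (y * (X * (X * (X * (y * (X * (X * v)))))))))) ((r11 _).symm)
      _ = _ := congrArg (fun v => x * (x * (x * (y * (X * (X * v)))))) ((r16 _).symm)
      _ = _ := congrArg (fun v => x * (x * (x * (y * (X * (X * (y * (x * (x * (y * v)))))))))) ((r1 _).symm)
      _ = _ := congrArg (fun v => x * (x * (x * (y * (X * (X * (y * (x * (x * (y * (X * v))))))))))) ((r1 _).symm)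
      _ = _ := congrArg (fun v => x * (x * (x * (y * (X * (X * (y * (x * (x * (y * (X * (X * v)))))))))))) ((r1 _).symm)
  · calc _ = _ := r20 _
      _ = _ := congrArg (fun v => X * (X * v)) (r1 _)
      _ = _ := congrArg (fun v => X * (X * (y * v))) (r20 _)
      _ = _ := congrArg (fun v => X * (X * (y * (X * (X * v))))) (r1 _)
      _ = _ := congrArg (fun v => X * (X * (y * (X * v)))) (r1 _)
      _ = _ := congrArg (fun v => X * (X * (y * v))) (r1 _)
      _ = _ := congrArg (fun v => X * (X * v)) (r16 _)
      _ = _ := congrArg (fun v => X * v) (r41 _)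
      _ = _ := r1 _
      _ = _ := congrArg (fun v => y * (x * (x * (y * (X * (X * v)))))) ((r1 _).symm)
  · calc _ = _ := congrArg (fun v => x * (x * (y * (X * v)))) (r1 _)
      _ = _ := congrArg (fun v => x * (x * (y * v))) (r1 _)
      _ = _ := congrArg (fun v => x * (x * v)) (r2 _)
      _ = _ := congrArg (fun v => x * v) (r0 _)
      _ = _ := r0 _
  · exact congrArg (fun v => x * (x * (y * (X * (X * v))))) ((r1 _).symm)
  · calc _ = _ := congrArg (fun v => x * (y * (x * v))) (r0 _)
      _ = _ := congrArg (fun v => x * (y * v)) (r0 _)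
      _ = _ := congrArg (fun v => x * v) (r15 _)
      _ = _ := congrArg (fun v => x * (x * (y * v))) (r0 _)
      _ = _ := congrArg (fun v => x * (x * (y * (X * (X * v))))) (r56 _)
      _ = _ := congrArg (fun v => x * (x * (y * (X * v)))) (r1 _)
      _ = _ := congrArg (fun v => x * (x * v)) (r15 _)
      _ = _ := congrArg (fun v => x * (x * (x * (y * v)))) (r0 _)
      _ = _ := congrArg (fun v => x * (x * (x * v))) (r15 _)
      _ = _ := r20 _
      _ = _ := congrArg (fun v => X * (X * (X * (y * v)))) (r20 _)
  · calc _ = _ := r0 _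
      _ = _ := congrArg (fun v => X * (X * (y * (X * (X * (X * (y * v))))))) ((r1 _).symm)
      _ = _ := (r33 _).symm
      _ = _ := congrArg (fun v => x * (y * (x * (x * (x * (y * v)))))) ((r21 _).symm)
      _ = _ := congrArg (fun v => x * v) ((r0 _).symm)
      _ = _ := congrArg (fun v => x * (x * v)) ((r39 _).symm)
      _ = _ := congrArg (fun v => x * (x * (y * (X * (X * (X * (y * (x * (x * (x * (y * (X * v)))))))))))) ((r1 _).symm)
  · calc _ = _ := congrArg (fun v => x * (x * v)) (r39 _)
      _ = _ := congrArg (fun v => x * v) (r0 _)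
      _ = _ := congrArg (fun v => x * (y * (x * (x * (x * (y * v)))))) (r21 _)
      _ = _ := congrArg (fun v => x * (y * (x * (x * (x * (y * (x * (x * v)))))))) (r0 _)
      _ = _ := congrArg (fun v => x * (y * (x * (x * (x * (y * (x * v))))))) (r0 _)
      _ = _ := congrArg (fun v => x * (y * (x * (x * (x * v))))) (r11 _)
      _ = _ := congrArg (fun v => x * (y * (x * (x * v)))) (r0 _)
      _ = _ := congrArg (fun v => x * (y * (x * (x * (y * v))))) (r1 _)
      _ = _ := congrArg (fun v => x * v) (r16 _)
      _ = _ := r0 _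
      _ = _ := congrArg (fun v => y * (X * (X * v))) (r11 _)
      _ = _ := congrArg (fun v => y * (X * (X * (X * (y * v))))) (r21 _)
      _ = _ := r39 _
      _ = _ := congrArg (fun v => X * (y * (x * (x * (x * (y * (X * (X * v)))))))) (r1 _)
      _ = _ := congrArg (fun v => X * (y * (x * (x * (x * (y * (X * v))))))) (r1 _)
      _ = _ := congrArg (fun v => X * (y * (x * (x * (x * (y * v)))))) (r1 _)
      _ = _ := congrArg (fun v => X * (y * (x * (x * (x * v))))) (r2 _)
      _ = _ := congrArg (fun v => X * (y * (x * (x * v)))) (r0 _)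
      _ = _ := congrArg (fun v => X * (y * (x * v))) (r0 _)
      _ = _ := congrArg (fun v => X * (y * v)) (r0 _)
      _ = _ := congrArg (fun v => X * v) (r2 _)
      _ = _ := r1 _
  · calc _ = _ := r58 _
      _ = _ := (r39 _).symm
      _ = _ := congrArg (fun v => y * (X * (X * (X * (y * (x * (x * (x * (y * v))))))))) ((r1 _).symm)
      _ = _ := congrArg (fun v => y * (X * (X * (X * (y * (x * (x * (x * (y * (X * v)))))))))) ((r1 _).symm)
      _ = _ := congrArg (fun v => y * (X * (X * (X * (y * (x * (x * (x * (y * (X * (X * v))))))))))) ((r1 _).symm)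
      _ = _ := congrArg (fun v => y * (X * (X * (X * (y * (x * (x * (x * (y * v))))))))) ((r20 _).symm)
      _ = _ := congrArg (fun v => y * v) ((r20 _).symm)
      _ = _ := congrArg (fun v => y * (x * (x * (x * (x * (y * (x * (x * v)))))))) ((r15 _).symm)
      _ = _ := congrArg (fun v => y * (x * (x * (x * v)))) ((r17 _).symm)
      _ = _ := congrArg (fun v => y * (x * (x * (x * (y * (X * (X * (y * (X * (X * v)))))))))) ((r1 _).symm)
      _ = _ := congrArg (fun v => y * (x * (x * (x * (y * (X * (X * (y * v)))))))) ((r20 _).symm)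
  · calc _ = _ := r20 _
      _ = _ := congrArg (fun v => X * (X * v)) (r1 _)
      _ = _ := congrArg (fun v => X * (X * (y * v))) (r20 _)
      _ = _ := congrArg (fun v => X * (X * (y * (X * (X * v))))) (r1 _)
      _ = _ := congrArg (fun v => X * (X * (y * (X * v)))) (r1 _)
      _ = _ := congrArg (fun v => X * (X * (y * v))) (r1 _)
      _ = _ := congrArg (fun v => X * (X * v)) (r11 _)
      _ = _ := congrArg (fun v => X * (X * (X * (y * v)))) (r21 _)
      _ = _ := r74 _
      _ = _ := (r74 _).symm
      _ = _ := (r20 _).symm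
      _ = _ := congrArg (fun v => x * (x * (x * (x * (y * (x * (x * v))))))) ((r15 _).symm)
      _ = _ := congrArg (fun v => x * (x * (x * v))) ((r17 _).symm)
      _ = _ := congrArg (fun v => x * (x * (x * (y * (X * (X * (y * (X * (X * v))))))))) ((r1 _).symm)
      _ = _ := congrArg (fun v => x * (x * (x * (y * (X * (X * (y * v))))))) ((r20 _).symm)
  · calc _ = _ := r20 _
      _ = _ := congrArg (fun v => X * (X * v)) (r1 _)
      _ = _ := congrArg (fun v => X * (X * v)) (r56 _)
      _ = _ := congrArg (fun v => X * v) (r1 _)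
      _ = _ := r22 _
  · rfl
  · calc _ = _ := r20 _
      _ = _ := congrArg (fun v => X * (X * v)) (r1 _)
      _ = _ := congrArg (fun v => X * (X * (y * v))) (r20 _)
      _ = _ := congrArg (fun v => X * (X * (y * (X * (X * v))))) (r1 _)
      _ = _ := congrArg (fun v => X * (X * (y * (X * v)))) (r1 _)
      _ = _ := congrArg (fun v => X * (X * (y * v))) (r1 _)
      _ = _ := congrArg (fun v => X * (X * v)) (r11 _)
      _ = _ := congrArg (fun v => X * (X * (X * (y * (X * (X * (X * v))))))) ((r2 _).symm)
      _ = _ := (r47 _).symm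
      _ = _ := congrArg (fun v => y * (x * (x * (x * (y * v))))) ((r1 _).symm)
      _ = _ := congrArg (fun v => y * (x * (x * (x * (y * (X * v)))))) ((r1 _).symm)
  · calc _ = _ := congrArg (fun v => x * (x * (x * (y * (x * (x * v)))))) (r23 _)
      _ = _ := congrArg (fun v => x * v) (r40 _)
      _ = _ := r0 _
      _ = _ := congrArg (fun v => y * (X * (X * (y * (x * (x * v)))))) (r2 _)
      _ = _ := congrArg (fun v => y * (X * (X * (y * v)))) (r20 _)
      _ = _ := congrArg (fun v => y * (X * (X * (y * (X * (X * v)))))) (r1 _)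
      _ = _ := r17 _
      _ = _ := congrArg (fun v => x * (y * (x * (x * v)))) (r15 _)
      _ = _ := congrArg (fun v => x * (y * (x * (x * (x * (y * v)))))) (r20 _)
      _ = _ := congrArg (fun v => x * v) (r50 _)
      _ = _ := congrArg (fun v => x * (x * (y * (X * (X * (X * (y * (x * (x * v))))))))) (r0 _)
      _ = _ := congrArg (fun v => x * (x * (y * (X * (X * (X * (y * (x * v)))))))) (r0 _)

/-- The key computation, in any group. -/
theorem key_comm {M : Type*} [Group M] (p q r s a b c : M)
    (hp : p * p = 1) (hq : q * q = 1) (hr : r * r = 1) (hs : s * s = 1)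
    (haa : a * a = 1) (hbb : b * b = 1) (hc4 : c ^ 4 = 1)
    (hA : (a * s) ^ 5 = 1) (hB : (b * q) ^ 5 = 1) (hC : (c⁻¹ * p) ^ 5 = 1)
    (hsa : s * a = a * p) (hqb : q * b = b * p)
    (hpc : p * c = c * s) (hsc : s * c = c * r) (hrc : r * c = c * q) (hqc : q * c = c * p)
    (hsb : s * b = b * r) (hacb : a * c * b = c) : p * r * p * r = 1 := by
  -- inverses of the involutions
  have swap : ∀ u v g : M, g * g = 1 → u * g = g * v → v * g = g * u := by
    intro u v g hg h
    calc v * g = (g * g) * v * g := by rw [hg, one_mul]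
      _ = g * (g * v) * g := by group
      _ = g * u * (g * g) := by rw [← h]; group
      _ = g * u := by rw [hg, mul_one]
  have five : ∀ u v g : M, u * u = 1 → g * g = 1 → u * g = g * v → (g * u) ^ 5 = 1 →
      v * u * v * u * v = g := by
    intro u v g hu hg h h5
    have h' := swap u v g hg h
    have e : (g * u) ^ 5 = v * u * v * u * v * g := by
      calc (g * u) ^ 5 = (g * u) * g * u * (g * u) * g * u * (g * u) := by
            simp only [pow_succ, pow_zero, one_mul, mul_one, mul_assoc]
        _ = (v * g) * g * u * (v * g) * g * u * (v * g) := by rw [h']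
        _ = v * (g * g) * u * v * (g * g) * u * v * g := by group
        _ = v * u * v * u * v * g := by rw [hg]; group
    rw [e] at h5
    calc v * u * v * u * v = v * u * v * u * v * (g * g) := by rw [hg, mul_one]
      _ = (v * u * v * u * v * g) * g := by group
      _ = g := by rw [h5, one_mul]
  have hA' : p * s * p * s * p = a := five s p a hs haa hsa hA
  have hB' : p * q * p * q * p = b := five q p b hq hbb hqb hB
  -- move `c⁻¹` to the left
  have mv : ∀ u v : M, u * c = c * v → c⁻¹ * u = v * c⁻¹ := by
    intro u v h
    rw [inv_mul_eq_iff_eq_mul, ← mul_assoc, ← h]; group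
  have mp := mv _ _ hpc
  have ms := mv _ _ hsc
  have mr := mv _ _ hrc
  have mq := mv _ _ hqc
  have hC' : s * r * q * p * s = c := by
    have h4 : c⁻¹ * c⁻¹ * c⁻¹ * c⁻¹ = 1 := by
      have : c⁻¹ * c⁻¹ * c⁻¹ * c⁻¹ = (c ^ 4)⁻¹ := by group
      rw [this, hc4, inv_one]
    have e : (c⁻¹ * p) ^ 5 = s * r * q * p * s * c⁻¹ := by
      calc (c⁻¹ * p) ^ 5
          = (c⁻¹ * p) * (c⁻¹ * p) * (c⁻¹ * p) * (c⁻¹ * p) * (c⁻¹ * p) := by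
            simp only [pow_succ, pow_zero, one_mul, mul_one, mul_assoc]
        _ = (s * c⁻¹) * (s * c⁻¹) * (s * c⁻¹) * (s * c⁻¹) * (s * c⁻¹) := by rw [mp]
        _ = s * (c⁻¹ * s) * c⁻¹ * (s * c⁻¹) * s * (c⁻¹ * s) * c⁻¹ := by group
        _ = s * (r * c⁻¹) * c⁻¹ * (s * c⁻¹) * s * (r * c⁻¹) * c⁻¹ := by rw [ms]
        _ = s * r * (c⁻¹ * (c⁻¹ * s)) * (c⁻¹ * s) * r * c⁻¹ * c⁻¹ := by group
        _ = s * r * ((c⁻¹ * r) * c⁻¹) * (r * c⁻¹) * r * c⁻¹ * c⁻¹ := by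
            rw [ms, ← mul_assoc c⁻¹ r]
        _ = s * r * ((q * c⁻¹) * c⁻¹) * (r * c⁻¹) * r * c⁻¹ * c⁻¹ := by rw [mr]
        _ = s * r * q * c⁻¹ * (c⁻¹ * r) * (c⁻¹ * r) * c⁻¹ * c⁻¹ := by group
        _ = s * r * q * c⁻¹ * (q * c⁻¹) * (q * c⁻¹) * c⁻¹ * c⁻¹ := by rw [mr]
        _ = s * r * q * (c⁻¹ * q) * (c⁻¹ * q) * c⁻¹ * c⁻¹ * c⁻¹ := by group
        _ = s * r * q * (p * c⁻¹) * (p * c⁻¹) * c⁻¹ * c⁻¹ * c⁻¹ := by rw [mq]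
        _ = s * r * q * p * (c⁻¹ * p) * (c⁻¹ * c⁻¹ * c⁻¹ * c⁻¹) := by group
        _ = s * r * q * p * (s * c⁻¹) := by rw [mp, h4, mul_one]
        _ = s * r * q * p * s * c⁻¹ := by group
    rw [e] at hC
    exact mul_inv_eq_one.mp hC
  -- rotations of the last relation
  have hC1 : p * s * r * q * p = c := by
    calc p * s * r * q * p = p * (s * r * q * p * s) * s⁻¹ := by group
      _ = (p * c) * s⁻¹ := by rw [hC']
      _ = c := by rw [hpc]; group
  have hC2 : q * p * s * r * q = c := by
    calc q * p * s * r * q = q * (p * s * r * q * p) * p⁻¹ := by group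
      _ = (q * c) * p⁻¹ := by rw [hC1]
      _ = c := by rw [hqc]; group
  have hC3 : r * q * p * s * r = c := by
    calc r * q * p * s * r = r * (q * p * s * r * q) * q⁻¹ := by group
      _ = (r * c) * q⁻¹ := by rw [hC2]
      _ = c := by rw [hrc]; group
  have ip : p⁻¹ = p := inv_eq_of_mul_eq_one_left hp
  have iq : q⁻¹ = q := inv_eq_of_mul_eq_one_left hq
  have ir : r⁻¹ = r := inv_eq_of_mul_eq_one_left hr
  have is : s⁻¹ = s := inv_eq_of_mul_eq_one_left hs
  have hrb : r * b = b * s := swap _ _ _ hbb hsb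
  have hD : c * (r * s * p * q * r) = 1 := by
    have : r * s * p * q * r = c⁻¹ := by
      rw [← hC3]; simp only [mul_inv_rev, ip, iq, ir, is, mul_assoc]
    rw [this, mul_inv_cancel]
  have cp (z : M) : p * (p * z) = z := by rw [← mul_assoc, hp, one_mul]
  have cq (z : M) : q * (q * z) = z := by rw [← mul_assoc, hq, one_mul]
  have cr (z : M) : r * (r * z) = z := by rw [← mul_assoc, hr, one_mul]
  have cs (z : M) : s * (s * z) = z := by rw [← mul_assoc, hs, one_mul]
  have eA : a * (p * s * p * s) = p := by
    rw [← hA']; simp only [mul_assoc, cp, cs, hs, mul_one]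
  have eB : b * (p * q * p * q) = p := by
    rw [← hB']; simp only [mul_assoc, cp, cq, hq, mul_one]
  have eC : c * (p * q * r * s) = p := by
    rw [← hC1]; simp only [mul_assoc, cp, cq, cr, hs, mul_one]
  calc p * r * p * r = (a * (p * s * p * s)) * r * p * r := by rw [eA]
    _ = a * p * s * p * s * r * p * r := by group
    _ = a * p * s * (c * (p * q * r * s)) * s * r * p * r := by rw [eC]
    _ = a * (p * (s * c)) * p * q * p * r := by simp only [mul_assoc, cs, cr]
    _ = a * ((p * c) * r) * p * q * p * r := by rw [hsc]; group
    _ = a * c * s * r * p * q * p * r := by rw [hpc]; group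
    _ = a * c * s * r * (b * (p * q * p * q)) * q * p * r := by rw [eB]
    _ = a * c * (s * (r * b)) * p * q * r := by simp only [mul_assoc, cq, cp]
    _ = a * c * ((s * b) * s) * p * q * r := by rw [hrb]; group
    _ = (a * c * b) * r * s * p * q * r := by rw [hsb]; group
    _ = c * (r * s * p * q * r) := by rw [hacb]; group
    _ = 1 := hD

theorem rel_one {w : F} (h : w ∈ rels) : PresentedGroup.mk rels w = 1 :=
  PresentedGroup.one_of_mem h

theorem relx : x ^ 7 = 1 := by
  have h : fx ^ 7 ∈ rels := by simp [rels]
  exact rel_one h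
theorem rely : y ^ 2 = 1 := by
  have h : fy ^ 2 ∈ rels := by simp [rels]
  exact rel_one h
theorem relxy : (x * y) ^ 3 = 1 := by
  have h : (fx * fy) ^ 3 ∈ rels := by simp [rels]
  exact rel_one h
theorem relcomm : (x⁻¹ * y⁻¹ * x * y) ^ 4 = 1 := by
  have h : (fcomm fx fy) ^ 4 ∈ rels := by simp [rels]
  exact rel_one h
theorem relt : t ^ 2 = 1 := by
  have h : ft ^ 2 ∈ rels := by simp [rels]
  exact rel_one h
theorem relth : ((x ^ 2)⁻¹ * t * x ^ 2)⁻¹ * (y * x⁻¹)⁻¹ * ((x ^ 2)⁻¹ * t * x ^ 2) * (y * x⁻¹) = 1 := by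
  have h : fcomm (fconj ft (fx ^ 2)) (fy * fx⁻¹) ∈ rels := by simp [rels]
  exact rel_one h
theorem relty : t⁻¹ * y⁻¹ * t * y = 1 := by
  have h : fcomm ft fy ∈ rels := by simp [rels]
  exact rel_one h
theorem rel5 : (y * ((x ^ 2)⁻¹ * t * x ^ 2)) ^ 5 = 1 := by
  have h : (fy * fconj ft (fx ^ 2)) ^ 5 ∈ rels := by simp [rels]
  exact rel_one h
theorem rel5' : (x * y * x ^ 2 * (x⁻¹ * t * x)) ^ 5 = 1 := by
  have h : (fx * fy * fx ^ 2 * fconj ft fx) ^ 5 ∈ rels := by simp [rels]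
  exact rel_one h

theorem comm_ty : Commute t y := by
  have h := relty
  have : y * t = t * y := by
    calc y * t = y * t * (t⁻¹ * y⁻¹ * t * y) := by rw [h, mul_one]
      _ = t * y := by group
  exact this.symm

/-- `h = x² y x⁻³`, the second generator of the stabilizer of `t`. -/
def hh : G := x ^ 2 * y * (x⁻¹) ^ 3

theorem comm_th : Commute t hh := by
  have h := relth
  have : hh * t = t * hh := by
    unfold hh
    calc x ^ 2 * y * (x⁻¹) ^ 3 * t
        = x ^ 2 * y * (x⁻¹) ^ 3 * t * x ^ 2 * (((x ^ 2)⁻¹ * t * x ^ 2)⁻¹ * (y * x⁻¹)⁻¹ *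
          ((x ^ 2)⁻¹ * t * x ^ 2) * (y * x⁻¹)) * (x ^ 2)⁻¹ := by rw [h]; group
      _ = t * (x ^ 2 * y * (x⁻¹) ^ 3) := by group
  exact this.symm

/-- the conjugate of `t` by `u` -/
def tc (u : G) : G := u⁻¹ * t * u

theorem tc_eq {u v w : G} (hw : Commute t w) (h : u = w * v) : tc u = tc v := by
  subst h
  unfold tc
  calc (w * v)⁻¹ * t * (w * v) = v⁻¹ * w⁻¹ * (t * w) * v := by group
    _ = v⁻¹ * t * v := by rw [hw.eq]; group

theorem tc_mul {u v w g : G} (hw : Commute t w) (h : u * g = w * v) :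
    tc u * g = g * tc v := by
  rw [← tc_eq hw h]
  unfold tc
  group

theorem tc_sq (u : G) : tc u * tc u = 1 := by
  have h : t * t = 1 := by rw [← pow_two, relt]
  unfold tc
  calc u⁻¹ * t * u * (u⁻¹ * t * u) = u⁻¹ * (t * t) * u := by group
    _ = 1 := by rw [h]; group

theorem conj_pow_five {g n m c v w : G} (h : (n * tc v) ^ 5 = 1) (hn : n * g = g * m)
    (hw : Commute t w) (hv : v * g = w * c) : (m * tc c) ^ 5 = 1 := by
  have e := tc_mul hw hv
  have e1 : m * tc c = g⁻¹ * (n * tc v) * g := by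
    calc m * tc c = g⁻¹ * ((g * m) * tc c) := by group
      _ = g⁻¹ * (n * (g * tc c)) := by rw [← hn]; group
      _ = _ := by rw [← e]; group
  have e2 : (g⁻¹ * (n * tc v) * g) ^ 5 = g⁻¹ * (n * tc v) ^ 5 * g := by
    simp only [pow_succ, pow_zero, one_mul, mul_assoc, mul_inv_cancel_left]
  rw [e1, e2, h]; group

theorem key_one : tc x * tc (x ^ 5 * y) * tc x * tc (x ^ 5 * y) = 1 := by
  have c0 (z : G) : x * (x⁻¹ * z) = z := by group
  have c1 (z : G) : x⁻¹ * (x * z) = z := by group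
  have yy : y * y = 1 := by rw [← pow_two, rely]
  have yi : y⁻¹ = y := inv_eq_of_mul_eq_one_left yy
  have c2 (z : G) : y * (y * z) = z := by rw [← mul_assoc, yy, one_mul]
  have c3 (z : G) : x * (x * (x * (x * (x * (x * (x * z)))))) = z := by
    calc _ = x ^ 7 * z := by simp only [pow_succ, pow_zero, one_mul, mul_one, mul_assoc]
      _ = z := by rw [relx, one_mul]
  have c4 (z : G) : x * (y * (x * (y * (x * (y * z))))) = z := by
    calc _ = (x * y) ^ 3 * z := by simp only [pow_succ, pow_zero, one_mul, mul_one, mul_assoc]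
      _ = z := by rw [relxy, one_mul]
  have c5 (z : G) : x⁻¹ * (y * (x * (y * (x⁻¹ * (y * (x * (y * (x⁻¹ * (y * (x * (y * (x⁻¹ * (y * (x *
      (y * z))))))))))))))) = z := by
    have h := relcomm
    rw [yi] at h
    calc _ = (x⁻¹ * y * x * y) ^ 4 * z := by simp only [pow_succ, pow_zero, one_mul, mul_one, mul_assoc]
      _ = z := by rw [h, one_mul]
  have hhi : hh⁻¹ = x ^ 3 * y * (x⁻¹) ^ 2 := by
    unfold hh
    rw [mul_inv_rev, mul_inv_rev, yi]; group
  obtain ⟨haa, hk, hks, hsa, hbb, hqb, hm, hmp, hc4, hpc, hsc, hrc, hqc, hsb, hacb⟩ := psl_words x x⁻¹ y c0 c1 c2 c3 c4 c5 1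
  have nh : hh = x ^ 2 * y * (x⁻¹) ^ 3 := rfl
  have cy := comm_ty
  have ch := comm_th
  have cH := comm_th.inv_right
  have hb : y * x⁻¹ ^ 2 = x⁻¹ ^ 2 * (x ^ 2 * y * x⁻¹ ^ 2) := by group
  refine key_comm (tc x) (tc 1) (tc (x ^ 5 * y)) (tc (x ^ 5 * y * x ^ 6))
    (x ^ 3 * y * x ^ 3 * y) (x ^ 2 * y * x⁻¹ ^ 2) (x ^ 2 * y * x⁻¹ ^ 3 * y * x)
    (tc_sq _) (tc_sq _) (tc_sq _) (tc_sq _) ?_ ?_ ?_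
    (conj_pow_five (g := x⁻¹ ^ 3 * y * x) (w := hh⁻¹ * y * hh) rel5 ?_
      ((cH.mul_right cy).mul_right ch) ?_)
    (conj_pow_five (g := x⁻¹ ^ 2) (w := 1) rel5 hb (Commute.one_right t) ?_)
    (conj_pow_five (g := x⁻¹ ^ 3 * y * x⁻¹ ^ 3 * y) (w := hh * y * hh⁻¹) rel5' ?_
      ((ch.mul_right cy).mul_right cH) ?_)
    (tc_mul (w := y * hh) (cy.mul_right ch) ?_)
    (tc_mul (w := hh) ch ?_)
    (tc_mul (w := y * hh⁻¹ * y) ((cy.mul_right cH).mul_right cy) ?_)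
    (tc_mul (w := hh⁻¹ * y) (cH.mul_right cy) ?_)
    (tc_mul (w := y * hh * y) ((cy.mul_right ch).mul_right cy) ?_)
    (tc_mul (w := hh * y) (ch.mul_right cy) ?_)
    (tc_mul (w := y * hh⁻¹) (cy.mul_right cH) ?_) ?_
  · simpa only [pow_succ, pow_zero, one_mul, mul_one, mul_assoc] using haa
  · simpa only [pow_succ, pow_zero, one_mul, mul_one, mul_assoc] using hbb
  · simpa only [pow_succ, pow_zero, one_mul, mul_one, mul_assoc] using hc4
  · simpa only [pow_succ, pow_zero, one_mul, mul_one, mul_assoc] using hk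
  · rw [hhi, nh]; simpa only [pow_succ, pow_zero, one_mul, mul_one, mul_assoc] using hks
  · group
  · rw [← mul_assoc, eq_mul_inv_iff_mul_eq]
    simpa only [pow_succ, pow_zero, one_mul, mul_one, mul_assoc] using hm
  · rw [hhi, nh]; simpa only [pow_succ, pow_zero, one_mul, mul_one, mul_assoc] using hmp
  · rw [nh]; simpa only [pow_succ, pow_zero, one_mul, mul_one, mul_assoc] using hsa
  · rw [nh]; simpa only [pow_succ, pow_zero, one_mul, mul_one, mul_assoc] using hqb
  · rw [hhi]; simpa only [pow_succ, pow_zero, one_mul, mul_one, mul_assoc] using hpc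
  · rw [hhi]; simpa only [pow_succ, pow_zero, one_mul, mul_one, mul_assoc] using hsc
  · rw [nh]; simpa only [pow_succ, pow_zero, one_mul, mul_one, mul_assoc] using hrc
  · rw [nh]; simpa only [pow_succ, pow_zero, one_mul, mul_one, mul_assoc] using hqc
  · rw [hhi]; simpa only [pow_succ, pow_zero, one_mul, mul_one, mul_assoc] using hsb
  · simpa only [pow_succ, pow_zero, one_mul, mul_one, mul_assoc] using hacb

theorem s_involution_aux (i : ℕ) (hi : i ∈ Finset.Icc 1 7) :
    (tt i * tt (i + 7)) ^ 2 = 1 ∧ tt i * tt (i + 7) = tt (i + 7) * tt i := by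
  obtain ⟨h1, h7⟩ := Finset.mem_Icc.mp hi
  obtain ⟨k, rfl⟩ : ∃ k, i = k + 1 := ⟨i - 1, by omega⟩
  have e1 : tt (k + 1) = tc (x ^ (k + 1)) := by
    have h : (k + 1 - 1) % 14 + 1 = k + 1 := by omega
    simp only [tt, h, if_pos h7, tc]
  have e2 : tt (k + 1 + 7) = tc (x ^ 5 * y * x ^ k) := by
    have h : (k + 1 + 7 - 1) % 14 + 1 = k + 8 := by omega
    have h' : ¬ (k + 8 ≤ 7) := by omega
    simp only [tt, h, if_neg h', tc, Nat.add_sub_cancel]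
  have hsq : (tt (k + 1) * tt (k + 1 + 7)) ^ 2 = 1 := by
    have e : (tc (x ^ (k + 1)) * tc (x ^ 5 * y * x ^ k)) ^ 2
        = (x ^ k)⁻¹ * (tc x * tc (x ^ 5 * y) * tc x * tc (x ^ 5 * y)) * x ^ k := by
      rw [pow_succ' x k, pow_two]
      unfold tc
      simp only [mul_inv_rev, mul_assoc, mul_inv_cancel_left]
    rw [e1, e2, e, key_one]; group
  refine ⟨hsq, ?_⟩
  have q1 : tt (k + 1) * tt (k + 1) = 1 := by rw [e1, tc_sq]
  have q2 : tt (k + 1 + 7) * tt (k + 1 + 7) = 1 := by rw [e2, tc_sq]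
  have i1 := inv_eq_of_mul_eq_one_left q1
  have i2 := inv_eq_of_mul_eq_one_left q2
  have h := inv_eq_of_mul_eq_one_left ((pow_two _).symm.trans hsq)
  rw [mul_inv_rev, i1, i2] at h
  exact h.symm

/-- For `i = 1, …, 7` the element `sᵢ = tᵢ t₍ᵢ₊₇₎` is an involution;
equivalently `tᵢ` and `t₍ᵢ₊₇₎` commute, so `sᵢ = s₍ᵢ₊₇₎ = t₍ᵢ₊₇₎ tᵢ`. -/
theorem s_involution :
    ∀ i ∈ Finset.Icc 1 7,
      (tt i * tt (i + 7)) ^ 2 = 1 ∧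
        tt i * tt (i + 7) = tt (i + 7) * tt i := by
  intro i hi
  exact s_involution_aux i hi

end M22
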